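/- arXiv:1101.1941 — 2 statements merged into one kernel-verified Lean document; each statement's English description precedes it below -/
import Mathlib

section
/- For any solution for A by weighted allowed rectangles, for all leaves l' and l'' of T_2 having a common ancestor u, the vector C_{l'} − C_{l''} equals the sum of V_v over all nodes v on the path from u down to l' (excluding v = u) minus the sum of V_v over all nodes v on the path from u down to l'' (excluding v = u). -/
/-- A finite rooted tree whose leaves are exactly `Fin m`. -/
structure RTree (m : ℕ) where
  V : Type
  [fin : Fintype V]
  root : V
  parent : V → V
  parent_root : parent root = root
  reaches_root : ∀ v : V, ∃ k : ℕ, parent^[k] v = root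
  leaf : Fin m → V
  leaf_inj : Function.Injective leaf
  leaf_iff : ∀ v : V, (∀ u : V, parent u = v → u = v) ↔ ∃ i : Fin m, leaf i = v

attribute [instance] RTree.fin

/-- The set of leaf descendants of a node. -/
def RTree.lset {m : ℕ} (T : RTree m) (v : T.V) : Set (Fin m) :=
  {i | ∃ k : ℕ, T.parent^[k] (T.leaf i) = v}

/-- Every internal node has at least two children. -/
def RTree.TwoChildren {m : ℕ} (T : RTree m) : Prop :=
  ∀ v : T.V, (∃ u : T.V, u ≠ v ∧ T.parent u = v) →
    ∃ u u' : T.V, u ≠ v ∧ u' ≠ v ∧ u ≠ u' ∧ T.parent u = v ∧ T.parent u' = v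

/-- A 1-d solution for the vector `V0`, w.r.t. the tree `T1`. -/
def Sol1 {m : ℕ} (T1 : RTree m) (V0 : Fin m → ℝ) (w : Set (Fin m) → ℝ) : Prop :=
  (Function.support w).Finite ∧
  (∀ s : Set (Fin m), w s ≠ 0 → ∃ u : T1.V, s = T1.lset u) ∧
  (∀ i : Fin m, ∑ᶠ s ∈ {s : Set (Fin m) | i ∈ s}, w s = V0 i)

noncomputable def Opt1 {m : ℕ} (T1 : RTree m) (V0 : Fin m → ℝ) : ℕ :=
  sInf {k : ℕ | ∃ w : Set (Fin m) → ℝ, Sol1 T1 V0 w ∧ (Function.support w).ncard = k}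

/-- A solution for the matrix `A` by weighted allowed rectangles. -/
def Sol2 {m n : ℕ} (T1 : RTree m) (T2 : RTree n) (A : Fin m → Fin n → ℝ)
    (w : Set (Fin m) × Set (Fin n) → ℝ) : Prop :=
  (Function.support w).Finite ∧
  (∀ p : Set (Fin m) × Set (Fin n), w p ≠ 0 →
      ∃ (u : T1.V) (v : T2.V), p = (T1.lset u, T2.lset v)) ∧
  (∀ (i : Fin m) (j : Fin n),
      ∑ᶠ p ∈ {p : Set (Fin m) × Set (Fin n) | i ∈ p.1 ∧ j ∈ p.2}, w p = A i j)

noncomputable def Opt2 {m n : ℕ} (T1 : RTree m) (T2 : RTree n) (A : Fin m → Fin n → ℝ) : ℕ :=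
  sInf {k : ℕ | ∃ w : Set (Fin m) × Set (Fin n) → ℝ,
    Sol2 T1 T2 A w ∧ (Function.support w).ncard = k}

/-- The vector `V_v` determined by a solution `w`. -/
noncomputable def colVec {m n : ℕ} (T2 : RTree n)
    (w : Set (Fin m) × Set (Fin n) → ℝ) (v : T2.V) : Fin m → ℝ :=
  fun i => ∑ᶠ p ∈ {p : Set (Fin m) × Set (Fin n) | p.2 = T2.lset v ∧ i ∈ p.1}, w p

/-- Combine a family of 1-d weight assignments, crossing the one for node `u` with `S²_u`. -/
noncomputable def combine {m n : ℕ} (T2 : RTree n) (w1 : T2.V → (Set (Fin m) → ℝ)) :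
    Set (Fin m) × Set (Fin n) → ℝ :=
  fun p => ∑ᶠ u ∈ {u : T2.V | T2.lset u = p.2}, w1 u p.1

namespace RTree

variable {m : ℕ} (T : RTree m)

/-- The node `a` is a (weak) descendant of `b`. -/
def Below (a b : T.V) : Prop := ∃ k : ℕ, T.parent^[k] a = b

variable {T}

theorem Below.refl (a : T.V) : T.Below a a := ⟨0, rfl⟩

theorem Below.trans {a b c : T.V} : T.Below a b → T.Below b c → T.Below a c := by
  rintro ⟨k, rfl⟩ ⟨l, rfl⟩
  exact ⟨l + k, Function.iterate_add_apply ..⟩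

theorem iterate_parent_root (k : ℕ) : T.parent^[k] T.root = T.root :=
  Function.iterate_fixed T.parent_root k

theorem eq_root_of_iterate_eq_self {a : T.V} {k : ℕ} (hk : 0 < k)
    (h : T.parent^[k] a = a) : a = T.root := by
  obtain ⟨j, hj⟩ := T.reaches_root a
  have hfix : T.parent^[k * j] a = a := by
    rw [Function.iterate_mul]
    exact Function.iterate_fixed h j
  obtain ⟨d, hd⟩ : ∃ d, k * j = d + j :=
    ⟨k * j - j, by have := Nat.le_mul_of_pos_left j hk; omega⟩
  rw [hd, Function.iterate_add_apply, hj, iterate_parent_root] at hfix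
  exact hfix.symm

theorem Below.antisymm {a b : T.V} : T.Below a b → T.Below b a → a = b := by
  rintro ⟨k, rfl⟩ ⟨l, hl⟩
  rcases Nat.eq_zero_or_pos k with rfl | hk
  · rfl
  · rw [← Function.iterate_add_apply] at hl
    have ha := eq_root_of_iterate_eq_self (by omega) hl
    rw [ha, iterate_parent_root]

/-- Two ancestors of a common node are comparable. -/
theorem Below.total {a b c : T.V} : T.Below a b → T.Below a c → T.Below b c ∨ T.Below c b := by
  rintro ⟨k, rfl⟩ ⟨l, rfl⟩
  rcases le_total k l with h | h
  · left
    refine ⟨l - k, ?_⟩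
    rw [← Function.iterate_add_apply, Nat.sub_add_cancel h]
  · right
    refine ⟨k - l, ?_⟩
    rw [← Function.iterate_add_apply, Nat.sub_add_cancel h]

theorem Below.parent_of_ne {a b : T.V} (h : T.Below a b) (hne : a ≠ b) :
    T.Below (T.parent a) b := by
  obtain ⟨k, hk⟩ := h
  cases k with
  | zero => exact absurd hk hne
  | succ k => exact ⟨k, hk⟩

/-- A proper ancestor is reached through one of its children. -/
theorem Below.exists_child {a b : T.V} (h : T.Below a b) (hne : a ≠ b) :
    ∃ c, c ≠ b ∧ T.parent c = b ∧ T.Below a c := by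
  obtain ⟨k, hk⟩ := h
  induction k with
  | zero => exact absurd hk hne
  | succ k ih =>
    by_cases hc : T.parent^[k] a = b
    · exact ih hc
    · exact ⟨_, hc, by rw [← hk, Function.iterate_succ_apply'], k, rfl⟩

theorem lset_mono {a b : T.V} (h : T.Below a b) : T.lset a ⊆ T.lset b :=
  fun _ hi => Below.trans hi h

theorem lset_nonempty (v : T.V) : (T.lset v).Nonempty := by
  let _ : PartialOrder T.V :=
    { le := T.Below
      le_refl := Below.refl
      le_trans := fun _ _ _ => Below.trans
      le_antisymm := fun _ _ => Below.antisymm }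
  obtain ⟨a, hav, ha⟩ := Set.Finite.exists_le_minimal (Set.toFinite (Set.univ : Set T.V))
    (Set.mem_univ v)
  obtain ⟨i, rfl⟩ := (T.leaf_iff a).1 fun u hu =>
    Below.antisymm ⟨1, hu⟩ (ha.2 (Set.mem_univ u) ⟨1, hu⟩)
  exact ⟨i, hav⟩

theorem disjoint_lset_of_siblings {b c d : T.V} (hc : T.parent c = b) (hd : T.parent d = b)
    (hcb : c ≠ b) (hdb : d ≠ b) (hcd : c ≠ d) : Disjoint (T.lset c) (T.lset d) := by
  rw [Set.disjoint_left]
  intro i hic hid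
  rcases Below.total hic hid with h | h
  · exact hdb (Below.antisymm ⟨1, hd⟩ (hc ▸ h.parent_of_ne hcd))
  · exact hcb (Below.antisymm ⟨1, hc⟩ (hd ▸ h.parent_of_ne hcd.symm))

theorem TwoChildren.eq_of_below (hT : T.TwoChildren) {a b : T.V} (h : T.Below a b)
    (hab : T.lset a = T.lset b) : a = b := by
  by_contra hne
  obtain ⟨c, hcb, hc, hac⟩ := h.exists_child hne
  obtain ⟨d, hdb, hd, hcd⟩ : ∃ d, d ≠ b ∧ T.parent d = b ∧ c ≠ d := by
    obtain ⟨d, d', hdb, hdb', hdd', hd, hd'⟩ := hT b ⟨c, hcb, hc⟩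
    by_cases hcd : c = d
    · exact ⟨d', hdb', hd', hcd ▸ hdd'⟩
    · exact ⟨d, hdb, hd, hcd⟩
  obtain ⟨i, hi⟩ := lset_nonempty d
  have hib : i ∈ T.lset b := lset_mono ⟨1, hd⟩ hi
  exact Set.disjoint_left.1 (disjoint_lset_of_siblings hc hd hcb hdb hcd)
    (lset_mono hac (hab ▸ hib)) hi

theorem TwoChildren.lset_injective (hT : T.TwoChildren) : Function.Injective T.lset := by
  intro a b hab
  obtain ⟨i, hi⟩ := lset_nonempty a
  rcases Below.total hi (hab ▸ hi : i ∈ T.lset b) with h | h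
  · exact hT.eq_of_below h hab
  · exact (hT.eq_of_below h hab.symm).symm

/-- The ancestors of a leaf `l` below `u` split into those strictly below `u` and
the ancestors of `u`. -/
theorem setOf_mem_lset_eq_union {u : T.V} {l : Fin m} (hl : l ∈ T.lset u) :
    {v | l ∈ T.lset v} = {v | v ≠ u ∧ T.Below v u ∧ l ∈ T.lset v} ∪ {v | T.Below u v} := by
  ext v
  constructor
  · intro hv
    by_cases huv : T.Below u v
    · exact Or.inr huv
    · refine Or.inl ⟨?_, (Below.total hl hv).resolve_left huv, hv⟩
      rintro rfl
      exact huv (Below.refl v)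
  · rintro (hv | hv)
    · exact hv.2.2
    · exact lset_mono hv hl

theorem disjoint_below_above (u : T.V) (l : Fin m) :
    Disjoint {v | v ≠ u ∧ T.Below v u ∧ l ∈ T.lset v} {v | T.Below u v} :=
  Set.disjoint_left.2 fun _ hv huv => hv.1 (hv.2.1.antisymm huv)

end RTree

/-- Each entry of `A` is the sum of the entries of `V_v` over the ancestors `v` of its column. -/
theorem Sol2.eq_finsum_colVec {m n : ℕ} {A : Fin m → Fin n → ℝ} {T1 : RTree m} {T2 : RTree n}
    {w : Set (Fin m) × Set (Fin n) → ℝ} (hw : Sol2 T1 T2 A w) (hT2 : T2.TwoChildren)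
    (i : Fin m) (j : Fin n) :
    A i j = ∑ᶠ v ∈ {v : T2.V | j ∈ T2.lset v}, colVec T2 w v i := by
  obtain ⟨-, hrect, hsum⟩ := hw
  rw [← hsum i j]
  unfold colVec
  rw [← finsum_mem_biUnion _ (Set.toFinite _) fun _ _ => Set.toFinite _]
  · apply finsum_mem_inter_support_eq'
    intro p hp
    obtain ⟨a, v, rfl⟩ := hrect p hp
    simp only [Set.mem_ofPred_eq, Set.mem_iUnion, exists_prop]
    constructor
    · rintro ⟨hi, hj⟩
      exact ⟨v, hj, rfl, hi⟩
    · rintro ⟨v', hj, hv', hi⟩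
      exact ⟨hi, hv' ▸ hj⟩
  · intro v _ v' _ hne
    exact Set.disjoint_left.2 fun p hp hp' =>
      hne (hT2.lset_injective (hp.1.symm.trans hp'.1))

/-- An entry of `A` split at an ancestor `u` of its column. -/
theorem Sol2.eq_finsum_colVec_add {m n : ℕ} {A : Fin m → Fin n → ℝ} {T1 : RTree m}
    {T2 : RTree n} {w : Set (Fin m) × Set (Fin n) → ℝ} (hw : Sol2 T1 T2 A w)
    (hT2 : T2.TwoChildren) {u : T2.V} {l : Fin n} (hl : l ∈ T2.lset u) (i : Fin m) :
    A i l = (∑ᶠ v ∈ {v : T2.V | v ≠ u ∧ T2.Below v u ∧ l ∈ T2.lset v}, colVec T2 w v i) +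
      ∑ᶠ v ∈ {v : T2.V | T2.Below u v}, colVec T2 w v i := by
  rw [hw.eq_finsum_colVec hT2, RTree.setOf_mem_lset_eq_union hl,
    finsum_mem_union (RTree.disjoint_below_above u l) (Set.toFinite _) (Set.toFinite _)]

/-- for leaves `l'`, `l''` with common ancestor `u`, the vector
`C_{l'} - C_{l''}` equals the sum of `V_v` over the path from `u` down to `l'`
(excluding `u`) minus the sum over the path from `u` down to `l''` (excluding `u`). -/
theorem stmt3 {m n : ℕ} (A : Fin m → Fin n → ℝ) (T1 : RTree m) (T2 : RTree n)
    (hT2 : T2.TwoChildren)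
    (w : Set (Fin m) × Set (Fin n) → ℝ) (hw : Sol2 T1 T2 A w) :
    ∀ (u : T2.V) (l' l'' : Fin n), l' ∈ T2.lset u → l'' ∈ T2.lset u →
      ∀ i : Fin m,
        A i l' - A i l'' =
          (∑ᶠ v ∈ {v : T2.V | v ≠ u ∧ (∃ k : ℕ, T2.parent^[k] v = u) ∧ l' ∈ T2.lset v},
            colVec T2 w v i) -
          (∑ᶠ v ∈ {v : T2.V | v ≠ u ∧ (∃ k : ℕ, T2.parent^[k] v = u) ∧ l'' ∈ T2.lset v},
            colVec T2 w v i) := by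
  intro u l' l'' hl' hl'' i
  rw [hw.eq_finsum_colVec_add hT2 hl', hw.eq_finsum_colVec_add hT2 hl'']
  exact add_sub_add_right_eq_sub _ _ _
end

section
/- The minimum size of an interval solution for (a_k) equals (n + 1) − M*, where M* is the maximum number of parts in a partition of {0,1,…,n} into sets each of whose Δ-values sum to zero. (Note Σ_{k=0}^{n} Δ_k = 0, so such a partition always exists.) -/
/-- `a` padded with zeros: `a₀ = a_{n+1} = 0` (and beyond). -/
def pad (n : ℕ) (a : ℕ → ℝ) : ℕ → ℝ := fun k => if 1 ≤ k ∧ k ≤ n then a k else 0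

/-- `Δ_k = a_{k+1} - a_k` (with the zero-padding convention). -/
def Dlt (n : ℕ) (a : ℕ → ℝ) (k : ℕ) : ℝ := pad n a (k + 1) - pad n a k

/-- An interval solution for `a₁,…,a_n`: weights on the intervals `[i,j]`,
`1 ≤ i ≤ j ≤ n`, such that for each `k ∈ {1,…,n}` the weights of the intervals
containing `k` sum to `a_k`. -/
def IsIntSol (n : ℕ) (a : ℕ → ℝ) (w : ℕ → ℕ → ℝ) : Prop :=
  (∀ i j : ℕ, ¬(1 ≤ i ∧ i ≤ j ∧ j ≤ n) → w i j = 0) ∧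
  (∀ k ∈ Finset.Icc 1 n, ∑ i ∈ Finset.Icc 1 k, ∑ j ∈ Finset.Icc k n, w i j = a k)

/-- The size of an interval solution: the number of intervals with nonzero weight. -/
noncomputable def intSize (w : ℕ → ℕ → ℝ) : ℕ := {p : ℕ × ℕ | w p.1 p.2 ≠ 0}.ncard

open Finset in
/-- The pairs in `E` can be made monochromatic by a labelling of `range N` with at least `N - #E`
labels. -/
theorem exists_labelling (N : ℕ) (E : Finset (ℕ × ℕ)) :
    ∃ f : ℕ → ℕ, (∀ e ∈ E, f e.1 = f e.2) ∧ N ≤ ((range N).image f).card + E.card := by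
  induction E using Finset.induction_on with
  | empty => exact ⟨id, by simp, by simp⟩
  | insert e E he ih =>
    obtain ⟨f, hf, hc⟩ := ih
    refine ⟨fun x => if f x = f e.2 then f e.1 else f x, ?_, ?_⟩
    · intro e' he'
      rcases mem_insert.mp he' with rfl | h
      · simp
      · simp only [hf e' h]
    · have hsub : ((range N).image f).erase (f e.2) ⊆
          (range N).image (fun x => if f x = f e.2 then f e.1 else f x) := by
        intro y hy
        obtain ⟨hne, hy⟩ := mem_erase.mp hy
        obtain ⟨x, hx, rfl⟩ := mem_image.mp hy
        exact mem_image.mpr ⟨x, hx, by simp [hne]⟩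
      have h1 := card_le_card hsub
      have h2 := pred_card_le_card_erase (s := (range N).image f) (a := f e.2)
      rw [card_insert_of_notMem he]
      omega

theorem sum_Icc_Dlt (n : ℕ) (a : ℕ → ℝ) {k : ℕ} (hk : k ≤ n + 1) :
    ∑ j ∈ Finset.Icc k n, Dlt n a j = -pad n a k := by
  have h : Finset.Icc k n = Finset.Ico k (n + 1) := by ext; simp
  simp only [h, Dlt, Finset.sum_Ico_sub (pad n a) hk]
  simp [pad]

/-- `P` is a partition of `{0, …, n}` into parts on which `Δ` sums to zero. -/
def IsZeroSumPartition (n : ℕ) (a : ℕ → ℝ) (P : Finset (Finset ℕ)) : Prop :=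
  (∀ S ∈ P, S.Nonempty) ∧ (P : Set (Finset ℕ)).PairwiseDisjoint id ∧
    P.sup id = Finset.Icc 0 n ∧ ∀ S ∈ P, ∑ k ∈ S, Dlt n a k = 0

theorem isZeroSumPartition_singleton (n : ℕ) (a : ℕ → ℝ) :
    IsZeroSumPartition n a {Finset.Icc 0 n} := by
  refine ⟨by simp, by simp, by simp, ?_⟩
  simp only [Finset.mem_singleton, forall_eq]
  rw [sum_Icc_Dlt n a (Nat.zero_le _)]
  simp [pad]

theorem IsZeroSumPartition.card_le {n : ℕ} {a : ℕ → ℝ} {P : Finset (Finset ℕ)}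
    (hP : IsZeroSumPartition n a P) : P.card ≤ n + 1 := by
  obtain ⟨hne, hd, hs, -⟩ := hP
  have h : (P.biUnion id).card = ∑ S ∈ P, S.card := Finset.card_biUnion hd
  rw [← Finset.sup_eq_biUnion, hs, Nat.card_Icc] at h
  have h2 : ∑ S ∈ P, 1 ≤ ∑ S ∈ P, S.card :=
    Finset.sum_le_sum fun S hS => Finset.card_pos.mpr (hne S hS)
  simp only [Finset.sum_const, smul_eq_mul, mul_one] at h2
  omega

theorem IsIntSol.finite_support {n : ℕ} {a : ℕ → ℝ} {w : ℕ → ℕ → ℝ} (hw : IsIntSol n a w) :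
    {p : ℕ × ℕ | w p.1 p.2 ≠ 0}.Finite := by
  refine (Finset.finite_toSet (Finset.Icc 1 n ×ˢ Finset.Icc 1 n)).subset fun p hp => ?_
  have : 1 ≤ p.1 ∧ p.1 ≤ p.2 ∧ p.2 ≤ n := by
    by_contra h
    exact hp (hw.1 _ _ h)
  simp only [Finset.coe_product, Finset.coe_Icc, Set.mem_prod, Set.mem_Icc]
  omega

/-- All boundary cases of an interval solution at once. -/
theorem IsIntSol.pad_eq {n : ℕ} {a : ℕ → ℝ} {w : ℕ → ℕ → ℝ} (hw : IsIntSol n a w) (k : ℕ) :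
    pad n a k = ∑ i ∈ Finset.Icc 1 n, ∑ j ∈ Finset.Icc 1 n,
      if i ≤ k ∧ k ≤ j then w i j else 0 := by
  unfold pad
  split_ifs with hk
  · rw [← hw.2 k (by simpa using hk)]
    have h1 : Finset.Icc 1 k = (Finset.Icc 1 n).filter (· ≤ k) := by ext; simp; omega
    have h2 : Finset.Icc k n = (Finset.Icc 1 n).filter (k ≤ ·) := by ext; simp; omega
    rw [h1, h2, Finset.sum_filter]
    refine Finset.sum_congr rfl fun i _ => ?_
    split_ifs with hi
    · simp [Finset.sum_filter, hi]
    · simp [hi]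
  · symm
    refine Finset.sum_eq_zero fun i hi => Finset.sum_eq_zero fun j hj => if_neg ?_
    simp only [Finset.mem_Icc] at hi hj
    omega

theorem IsIntSol.Dlt_eq {n : ℕ} {a : ℕ → ℝ} {w : ℕ → ℕ → ℝ} (hw : IsIntSol n a w) (k : ℕ) :
    Dlt n a k = ∑ i ∈ Finset.Icc 1 n, ∑ j ∈ Finset.Icc 1 n,
      ((if k = i - 1 then w i j else 0) - if k = j then w i j else 0) := by
  unfold Dlt
  rw [hw.pad_eq, hw.pad_eq, ← Finset.sum_sub_distrib]
  refine Finset.sum_congr rfl fun i hi => ?_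
  rw [← Finset.sum_sub_distrib]
  refine Finset.sum_congr rfl fun j hj => ?_
  simp only [Finset.mem_Icc] at hi hj
  by_cases hij : i ≤ j
  · split_ifs <;> first | omega | simp
  · simp [hw.1 i j (by omega)]

/-- Contracting the intervals of a solution yields a zero-sum partition. -/
theorem IsIntSol.exists_partition {n : ℕ} {a : ℕ → ℝ} {w : ℕ → ℕ → ℝ} (hw : IsIntSol n a w) :
    ∃ P, IsZeroSumPartition n a P ∧ n + 1 ≤ P.card + intSize w := by
  obtain ⟨f, hf, hc⟩ := exists_labelling (n + 1)
    (hw.finite_support.toFinset.image fun p => (p.1 - 1, p.2))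
  have hlab : ∀ i j, w i j ≠ 0 → f (i - 1) = f j := fun i j h =>
    hf (i - 1, j) (Finset.mem_image.mpr ⟨(i, j), by simpa using h, rfl⟩)
  have hE : (hw.finite_support.toFinset.image fun p : ℕ × ℕ => (p.1 - 1, p.2)).card ≤
      intSize w := by
    rw [intSize, Set.ncard_eq_toFinset_card _ hw.finite_support]
    exact Finset.card_image_le
  let fib : ℕ → Finset ℕ := fun c => (Finset.range (n + 1)).filter fun k => f k = c
  have hmem : ∀ c k, k ∈ fib c ↔ k < n + 1 ∧ f k = c := fun c k => by simp [fib]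
  have hinj : Set.InjOn fib ((Finset.range (n + 1)).image f : Finset ℕ) := by
    intro c hc d _ hcd
    obtain ⟨x, hx, rfl⟩ := Finset.mem_image.mp (Finset.mem_coe.mp hc)
    have hx' : x ∈ fib (f x) := (hmem _ _).mpr ⟨Finset.mem_range.mp hx, rfl⟩
    rw [hcd] at hx'
    exact ((hmem _ _).mp hx').2
  refine ⟨((Finset.range (n + 1)).image f).image fib, ⟨?_, ?_, ?_, ?_⟩, ?_⟩
  · intro S hS
    simp only [Finset.mem_image, exists_exists_and_eq_and] at hS
    obtain ⟨x, hx, rfl⟩ := hS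
    exact ⟨x, (hmem _ _).mpr ⟨Finset.mem_range.mp hx, rfl⟩⟩
  · intro S hS T hT hST
    obtain ⟨c, _, rfl⟩ := Finset.mem_image.mp (Finset.mem_coe.mp hS)
    obtain ⟨d, _, rfl⟩ := Finset.mem_image.mp (Finset.mem_coe.mp hT)
    refine Finset.disjoint_left.mpr fun x hx hx' => hST ?_
    rw [← ((hmem _ _).mp hx).2, ← ((hmem _ _).mp hx').2]
  · ext x
    simp only [Finset.mem_sup, Finset.mem_image, exists_exists_and_eq_and, id, hmem,
      Finset.mem_range, Finset.mem_Icc]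
    constructor
    · rintro ⟨y, _, hx, _⟩
      omega
    · intro hx
      exact ⟨x, by omega, by omega, rfl⟩
  · intro S hS
    obtain ⟨c, _, rfl⟩ := Finset.mem_image.mp hS
    simp only [hw.Dlt_eq]
    rw [Finset.sum_comm]
    refine Finset.sum_eq_zero fun i hi => ?_
    rw [Finset.sum_comm]
    refine Finset.sum_eq_zero fun j hj => ?_
    rw [Finset.sum_sub_distrib, Finset.sum_ite_eq', Finset.sum_ite_eq']
    simp only [Finset.mem_Icc] at hi hj
    by_cases h0 : w i j = 0
    · simp [h0]
    · have h := hlab i j h0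
      simp only [hmem, h, show i - 1 < n + 1 by omega, show j < n + 1 by omega, sub_self]
  · rw [Finset.card_image_of_injOn hinj]
    omega

/-- Joining every element to the minimum of its part yields an interval solution. -/
theorem IsZeroSumPartition.exists_isIntSol {n : ℕ} {a : ℕ → ℝ} {P : Finset (Finset ℕ)}
    (hP : IsZeroSumPartition n a P) :
    ∃ w, IsIntSol n a w ∧ intSize w + P.card ≤ n + 1 := by
  obtain ⟨hne, hd, hs, hz⟩ := hP
  rw [Finset.sup_eq_biUnion] at hs
  let m : ℕ → ℕ := fun j => sInf {i | ∃ S ∈ P, i ∈ S ∧ j ∈ S}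
  have hm : ∀ S ∈ P, ∀ j ∈ S, m j = sInf (S : Set ℕ) := by
    intro S hS j hj
    refine congrArg sInf (Set.ext fun i => ⟨?_, fun hi => ⟨S, hS, hi, hj⟩⟩)
    rintro ⟨T, hT, hi, hj'⟩
    have : S = T := by
      by_contra hST
      exact Finset.disjoint_left.mp (hd hS hT hST) hj hj'
    exact this ▸ hi
  have hmin : ∀ S ∈ P, sInf (S : Set ℕ) ∈ S := fun S hS =>
    Finset.mem_coe.mp (Nat.sInf_mem (hne S hS))
  have hle : ∀ j, j ≤ n → m j ≤ j := by
    intro j hj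
    have : j ∈ P.biUnion id := by rw [hs]; simpa using hj
    obtain ⟨S, hS, hjS⟩ := Finset.mem_biUnion.mp this
    exact Nat.sInf_le ⟨S, hS, hjS, hjS⟩
  let w : ℕ → ℕ → ℝ := fun i j =>
    if 1 ≤ i ∧ i ≤ j ∧ j ≤ n ∧ i = m j + 1 then -Dlt n a j else 0
  refine ⟨w, ⟨fun i j h => if_neg (by tauto), fun k hk => ?_⟩, ?_⟩
  · obtain ⟨hk1, hkn⟩ := Finset.mem_Icc.mp hk
    have hinner : ∀ j ∈ Finset.Icc k n, ∑ i ∈ Finset.Icc 1 k, w i j =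
        (if k ≤ m j then Dlt n a j else 0) - Dlt n a j := by
      intro j hj
      obtain ⟨hkj, hjn⟩ := Finset.mem_Icc.mp hj
      have : ∀ i ∈ Finset.Icc 1 k, w i j = if i = m j + 1 then -Dlt n a j else 0 := by
        intro i hi
        simp only [Finset.mem_Icc] at hi
        simp only [w]
        exact if_congr (by omega) rfl rfl
      rw [Finset.sum_congr rfl this, Finset.sum_ite_eq']
      simp only [Finset.mem_Icc]
      split_ifs <;> first | omega | simp
    have hzero : ∑ j ∈ Finset.Icc k n, (if k ≤ m j then Dlt n a j else 0) = 0 := by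
      have hext : ∑ j ∈ Finset.Icc k n, (if k ≤ m j then Dlt n a j else 0) =
          ∑ j ∈ P.biUnion id, (if k ≤ m j then Dlt n a j else 0) := by
        rw [hs]
        refine Finset.sum_subset (Finset.Icc_subset_Icc_left (Nat.zero_le _)) ?_
        intro j hj hj'
        simp only [Finset.mem_Icc] at hj hj'
        have := hle j hj.2
        exact if_neg (by omega)
      rw [hext, Finset.sum_biUnion hd]
      refine Finset.sum_eq_zero fun S hS => ?_
      have : ∀ j ∈ S, (if k ≤ m j then Dlt n a j else 0) =
          if k ≤ sInf (S : Set ℕ) then Dlt n a j else 0 := fun j hj => by rw [hm S hS j hj]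
      rw [id, Finset.sum_congr rfl this]
      split_ifs
      · exact hz S hS
      · simp
    rw [Finset.sum_comm, Finset.sum_congr rfl hinner, Finset.sum_sub_distrib, hzero,
      sum_Icc_Dlt n a (by omega)]
    simp [pad, hk1, hkn]
  · have hsupp : intSize w ≤ ((Finset.Icc 0 n).filter fun j => m j ≠ j).card := by
      refine le_trans ?_ (Finset.card_image_le (f := fun j => (m j + 1, j)))
      rw [intSize, ← Set.ncard_coe_finset]
      refine Set.ncard_le_ncard ?_ (Finset.finite_toSet _)
      rintro ⟨i, j⟩ hij
      have h : 1 ≤ i ∧ i ≤ j ∧ j ≤ n ∧ i = m j + 1 := by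
        by_contra h
        exact hij (if_neg h)
      refine Finset.mem_coe.mpr (Finset.mem_image.mpr ⟨j, ?_, by simp [h.2.2.2]⟩)
      simp only [Finset.mem_filter, Finset.mem_Icc]
      omega
    have hparts : P.card ≤ ((Finset.Icc 0 n).filter fun j => m j = j).card := by
      refine Finset.card_le_card_of_injOn (fun S => sInf (S : Set ℕ)) ?_ ?_
      · intro S hS
        refine Finset.mem_coe.mpr (Finset.mem_filter.mpr ⟨?_, hm S hS _ (hmin S hS)⟩)
        rw [← hs]
        exact Finset.mem_biUnion.mpr ⟨S, hS, hmin S hS⟩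
      · intro S hS T hT hST
        by_contra hne'
        refine Finset.disjoint_left.mp (hd hS hT hne') (hmin S hS) ?_
        have := hmin T hT
        rwa [← show sInf (S : Set ℕ) = sInf (T : Set ℕ) from hST] at this
    have := Finset.card_filter_add_card_filter_not (s := Finset.Icc 0 n) (fun j => m j = j)
    rw [Nat.card_Icc] at this
    simp only [ne_eq] at hsupp
    omega

/-- the minimum size of an interval solution equals `(n+1) - M*`,
where `M*` is the maximum number of parts in a partition of `{0,…,n}` into sets
each of whose `Δ`-values sum to zero. -/
theorem stmt10 (n : ℕ) (hn : 1 ≤ n) (a : ℕ → ℝ) :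
    sInf {K : ℕ | ∃ w : ℕ → ℕ → ℝ, IsIntSol n a w ∧ intSize w = K} =
    (n + 1) - sSup {M : ℕ | ∃ P : Finset (Finset ℕ),
      (∀ S ∈ P, S.Nonempty) ∧
      (P : Set (Finset ℕ)).PairwiseDisjoint id ∧
      P.sup id = Finset.Icc 0 n ∧
      (∀ S ∈ P, ∑ k ∈ S, Dlt n a k = 0) ∧
      P.card = M} := by
  set A := {K : ℕ | ∃ w : ℕ → ℕ → ℝ, IsIntSol n a w ∧ intSize w = K}
  set B := {M : ℕ | ∃ P : Finset (Finset ℕ),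
      (∀ S ∈ P, S.Nonempty) ∧
      (P : Set (Finset ℕ)).PairwiseDisjoint id ∧
      P.sup id = Finset.Icc 0 n ∧
      (∀ S ∈ P, ∑ k ∈ S, Dlt n a k = 0) ∧
      P.card = M}
  have hmemB : ∀ P, IsZeroSumPartition n a P → P.card ∈ B :=
    fun P ⟨h1, h2, h3, h4⟩ => ⟨P, h1, h2, h3, h4, rfl⟩
  have hbdd : BddAbove B := ⟨n + 1, by
    rintro M ⟨P, h1, h2, h3, h4, rfl⟩
    exact IsZeroSumPartition.card_le ⟨h1, h2, h3, h4⟩⟩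
  obtain ⟨P, h1, h2, h3, h4, hPM⟩ :=
    Nat.sSup_mem ⟨_, hmemB _ (isZeroSumPartition_singleton n a)⟩ hbdd
  obtain ⟨w, hw, hwP⟩ := IsZeroSumPartition.exists_isIntSol ⟨h1, h2, h3, h4⟩
  have hwA : intSize w ∈ A := ⟨w, hw, rfl⟩
  have hle : sInf A ≤ intSize w := Nat.sInf_le hwA
  obtain ⟨v, hv, hvA⟩ := Nat.sInf_mem ⟨_, hwA⟩
  obtain ⟨Q, hQ, hQv⟩ := hv.exists_partition
  have hQle : Q.card ≤ sSup B := le_csSup hbdd (hmemB Q hQ)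
  omega
end
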